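/- arXiv:2510.23943 — 2 statements merged into one kernel-verified Lean document; each statement's English description precedes it below -/
import Mathlib

section
/- Let n ≥ 1, W ∈ ℝ^n and b ∈ ℝ. Then for every y ∈ ℝ^n, the family over multi-indices k ∈ ℤ^n given by k ↦ (∏_{l=1}^n J_{k_l}(W_l)) · cos(⟨k, y⟩ + b), where ⟨k, y⟩ = ∑_{l=1}^n k_l y_l, is summable, and cos(∑_{l=1}^n W_l · sin(y_l) + b) = ∑_{k ∈ ℤ^n} (∏_{l=1}^n J_{k_l}(W_l)) · cos(⟨k, y⟩ + b). -/
/-- Bessel function of the first kind of natural order `k`. -/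
noncomputable def besselJNat (k : ℕ) (x : ℝ) : ℝ :=
  ∑' m : ℕ, (-1 : ℝ) ^ m / (Nat.factorial m * Nat.factorial (m + k)) * (x / 2) ^ (2 * m + k)

/-- Bessel function of the first kind of integer order `k`:
for `k < 0` it is defined as `(-1)^{-k} J_{-k}`. -/
noncomputable def besselJ (k : ℤ) (x : ℝ) : ℝ :=
  if 0 ≤ k then besselJNat k.toNat x
  else (-1 : ℝ) ^ (-k).toNat * besselJNat (-k).toNat x

lemma hasSum_mul_complex {α β : Type*} {f : α → ℂ} {g : β → ℂ} {s t : ℂ}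
    (hf : HasSum f s) (hg : HasSum g t) :
    HasSum (fun p : α × β => f p.1 * g p.2) (s * t) := by
  have hs : Summable (fun p : α × β => f p.1 * g p.2) := by
    apply summable_mul_of_summable_norm hf.summable.norm hg.summable.norm
  exact hf.mul hg hs

/-- Reindexing of pairs by difference and minimum. -/
def diffEquiv : ℤ × ℕ ≃ ℕ × ℕ where
  toFun p := (p.2 + p.1.toNat, p.2 + (-p.1).toNat)
  invFun p := ((p.1 : ℤ) - p.2, min p.1 p.2)
  left_inv := by
    rintro ⟨k, m⟩
    simp only [Prod.mk.injEq]
    omega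
  right_inv := by
    rintro ⟨p, q⟩
    simp only [Prod.mk.injEq]
    omega

lemma hasSum_bessel_zpow (x : ℝ) (t : ℂ) (ht : t ≠ 0) :
    HasSum (fun k : ℤ => (besselJ k x : ℂ) * t ^ k)
      (Complex.exp (((x : ℂ) / 2) * t) * Complex.exp (-((x : ℂ) / 2) * t⁻¹)) := by
  have key : ∀ z : ℂ, HasSum (fun n : ℕ => z ^ n / (n.factorial : ℂ)) (Complex.exp z) := by
    intro z
    rw [Complex.exp_eq_exp_ℂ]
    exact NormedSpace.expSeries_div_hasSum_exp z
  have h1 := key (((x : ℂ) / 2) * t)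
  have h2 := key (-((x : ℂ) / 2) * t⁻¹)
  have h3 := hasSum_mul_complex h1 h2
  have h4 := (diffEquiv.hasSum_iff).2 h3
  refine h4.prod_fiberwise ?_
  intro k
  have hs := h4.summable.prod_factor k
  refine hs.hasSum_iff.2 (Eq.symm ?_)
  simp only [diffEquiv, Function.comp, Equiv.coe_fn_mk]
  unfold besselJ besselJNat
  rcases le_or_gt 0 k with hk | hk
  · obtain ⟨j, rfl⟩ := Int.eq_ofNat_of_zero_le hk
    have e : (-(j : ℤ)).toNat = 0 := by omega
    rw [if_pos hk, Complex.ofReal_tsum, ← tsum_mul_right]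
    refine tsum_congr fun m => ?_
    simp only [e, Int.toNat_natCast, add_zero, zpow_natCast]
    push_cast
    rw [mul_pow, mul_pow, neg_pow ((x : ℂ) / 2), pow_add t, inv_pow]
    field_simp
    ring
  · obtain ⟨j, hj⟩ := Int.eq_ofNat_of_zero_le (neg_nonneg.2 hk.le)
    obtain rfl : k = -(j : ℤ) := by omega
    have e : (-(j : ℤ)).toNat = 0 := by omega
    rw [if_neg (not_le.2 hk), ← tsum_mul_left, Complex.ofReal_tsum, ← tsum_mul_right]
    refine tsum_congr fun m => ?_
    simp only [e, neg_neg, Int.toNat_natCast, add_zero, zpow_neg, zpow_natCast]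
    push_cast
    rw [mul_pow, mul_pow, neg_pow ((x : ℂ) / 2), pow_add t⁻¹, inv_pow, inv_pow]
    field_simp
    ring

lemma hasSum_bessel_exp (x y : ℝ) :
    HasSum (fun k : ℤ => (besselJ k x : ℂ) * Complex.exp (((k : ℝ) * y : ℝ) * Complex.I))
      (Complex.exp ((x * Real.sin y : ℝ) * Complex.I)) := by
  have h := hasSum_bessel_zpow x (Complex.exp (y * Complex.I)) (Complex.exp_ne_zero _)
  convert h using 1
  · funext k
    rw [← Complex.exp_int_mul]
    push_cast
    ring_nf
  · rw [← Complex.exp_add, ← Complex.exp_neg]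
    congr 1
    push_cast
    rw [Complex.sin, neg_mul (y : ℂ)]
    linear_combination (-(x : ℂ) / 2 * (Complex.exp (y * Complex.I) - Complex.exp (-(y * Complex.I)))) * Complex.I_sq

lemma hasSum_pi_prod (n : ℕ) (f : Fin n → ℤ → ℂ) (s : Fin n → ℂ)
    (h : ∀ l, HasSum (f l) (s l)) :
    HasSum (fun k : Fin n → ℤ => ∏ l, f l (k l)) (∏ l, s l) := by
  induction n with
  | zero => simp
  | succ n ih =>
    have h1 := ih (fun l => f l.succ) (fun l => s l.succ) (fun l => h l.succ)
    have h2 := hasSum_mul_complex (h 0) h1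
    rw [← (Fin.consEquiv (fun _ : Fin (n + 1) => ℤ)).hasSum_iff, Fin.prod_univ_succ]
    convert h2 using 1
    funext p
    simp [Fin.consEquiv, Fin.prod_univ_succ]

theorem cos_expansion (n : ℕ) (hn : 1 ≤ n) (W : Fin n → ℝ) (b : ℝ) (y : Fin n → ℝ) :
    Summable (fun k : Fin n → ℤ =>
      (∏ l, besselJ (k l) (W l)) * Real.cos ((∑ l, (k l : ℝ) * y l) + b)) ∧
    Real.cos ((∑ l, W l * Real.sin (y l)) + b) =
      ∑' k : Fin n → ℤ,
        (∏ l, besselJ (k l) (W l)) * Real.cos ((∑ l, (k l : ℝ) * y l) + b) := by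
  have h := (hasSum_pi_prod n _ _ (fun l => hasSum_bessel_exp (W l) (y l))).mul_right
    (Complex.exp (b * Complex.I))
  have h' := Complex.hasSum_re h
  have hs : HasSum (fun k : Fin n → ℤ =>
      (∏ l, besselJ (k l) (W l)) * Real.cos ((∑ l, (k l : ℝ) * y l) + b))
      (Real.cos ((∑ l, W l * Real.sin (y l)) + b)) := by
    convert h' using 1
    · funext k
      rw [Finset.prod_mul_distrib, ← Complex.exp_sum, ← Finset.sum_mul, mul_assoc,
        ← Complex.exp_add, ← add_mul, ← Complex.ofReal_sum, ← Complex.ofReal_add,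
        ← Complex.ofReal_prod, Complex.re_ofReal_mul, Complex.exp_ofReal_mul_I_re]
    · rw [← Complex.exp_sum, ← Finset.sum_mul,
        ← Complex.exp_add, ← add_mul, ← Complex.ofReal_sum, ← Complex.ofReal_add,
        Complex.exp_ofReal_mul_I_re]
  exact ⟨hs.summable, hs.tsum_eq.symm⟩
end

section
/- For every w ∈ ℝ, b ∈ ℝ and y ∈ ℝ, the family k ∈ ℤ ↦ J_k(w) · cos(k·y + b) is summable and cos(w · sin(y) + b) = ∑_{k ∈ ℤ} J_k(w) · cos(k·y + b). -/
/-- Reindexing of pairs by difference and minimum. -/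
def jaEquiv : ℤ × ℕ ≃ ℕ × ℕ where
  toFun p := (p.2 + p.1.toNat, p.2 + (-p.1).toNat)
  invFun q := ((q.1 : ℤ) - q.2, min q.1 q.2)
  left_inv := by
    rintro ⟨k, j⟩
    ext <;> simp <;> omega
  right_inv := by
    rintro ⟨n, m⟩
    ext <;> simp <;> omega

lemma ja_term (w y : ℝ) (k : ℤ) (j : ℕ) :
    ((w / 2 : ℂ) * Complex.exp (y * Complex.I)) ^ (j + k.toNat) / ((j + k.toNat).factorial : ℂ) *
      ((-(w / 2 : ℂ) * Complex.exp (-(y * Complex.I))) ^ (j + (-k).toNat) /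
        ((j + (-k).toNat).factorial : ℂ)) =
    (((if 0 ≤ k then (1 : ℝ) else (-1) ^ (-k).toNat) * ((-1 : ℝ) ^ j /
      (Nat.factorial j * Nat.factorial (j + k.natAbs)) * (w / 2) ^ (2 * j + k.natAbs)) : ℝ) : ℂ) *
      Complex.exp (k * y * Complex.I) := by
  have hz : Complex.exp (y * Complex.I) * Complex.exp (-(y * Complex.I)) = 1 := by
    rw [← Complex.exp_add]; simp
  obtain ⟨n, rfl | rfl⟩ := k.eq_nat_or_neg
  · have h : Complex.exp (((n : ℤ) : ℂ) * y * Complex.I) = Complex.exp (y * Complex.I) ^ n := by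
      rw [← Complex.exp_nat_mul]; push_cast; ring_nf
    rw [h]
    generalize Complex.exp (y * Complex.I) = z at *
    generalize Complex.exp (-(y * Complex.I)) = z' at *
    have h2 : z ^ j * z' ^ j = 1 := by rw [← mul_pow, hz, one_pow]
    simp
    generalize (w / 2 : ℂ) = u
    linear_combination (u ^ (2 * j + n) * z ^ n * (-1) ^ j / (j.factorial : ℂ) /
      ((j + n).factorial : ℂ)) * h2
  · have h : Complex.exp (((-(n : ℤ) : ℤ) : ℂ) * y * Complex.I) =
        Complex.exp (-(y * Complex.I)) ^ n := by
      rw [← Complex.exp_nat_mul]; push_cast; ring_nf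
    have hif : (if 0 ≤ -(n : ℤ) then (1 : ℝ) else (-1) ^ (- -(n : ℤ)).toNat) = (-1) ^ n := by
      split_ifs with h0
      · have : n = 0 := by omega
        simp [this]
      · simp
    rw [h, hif]
    generalize Complex.exp (y * Complex.I) = z at *
    generalize Complex.exp (-(y * Complex.I)) = z' at *
    have h2 : z ^ j * z' ^ j = 1 := by rw [← mul_pow, hz, one_pow]
    simp
    generalize (w / 2 : ℂ) = u
    linear_combination (u ^ (2 * j + n) * z' ^ n * (-1) ^ (j + n) / (j.factorial : ℂ) /
      ((j + n).factorial : ℂ)) * h2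

lemma ja_inner (w : ℝ) (k : ℤ) :
    ∑' j : ℕ, ((if 0 ≤ k then (1 : ℝ) else (-1) ^ (-k).toNat) * ((-1 : ℝ) ^ j /
      (Nat.factorial j * Nat.factorial (j + k.natAbs)) * (w / 2) ^ (2 * j + k.natAbs)))
    = besselJ k w := by
  rw [tsum_mul_left, besselJ]
  split_ifs with h
  · rw [one_mul, show k.natAbs = k.toNat by omega]; rfl
  · rw [show k.natAbs = (-k).toNat by omega]; rfl

lemma ja_exp (x : ℂ) : HasSum (fun n : ℕ => x ^ n / (n.factorial : ℂ)) (Complex.exp x) := by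
  rw [Complex.exp_eq_exp_ℂ]; exact NormedSpace.expSeries_div_hasSum_exp x

lemma ja_norm (x : ℂ) : Summable (fun n : ℕ => ‖x ^ n / (n.factorial : ℂ)‖) :=
  NormedSpace.norm_expSeries_div_summable x

lemma ja_fiber (f g : ℕ → ℂ) (A B : ℂ) (hf : HasSum f A) (hg : HasSum g B)
    (hf' : Summable (fun n => ‖f n‖)) (hg' : Summable (fun n => ‖g n‖)) :
    HasSum (fun k : ℤ => ∑' j : ℕ, f (j + k.toNat) * g (j + (-k).toNat)) (A * B) := by
  have hs : Summable (fun p : ℕ × ℕ => f p.1 * g p.2) :=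
    summable_mul_of_summable_norm hf' hg'
  have H : HasSum (fun p : ℕ × ℕ => f p.1 * g p.2) (A * B) := hf.mul hg hs
  have H' : HasSum (fun p : ℤ × ℕ => f (p.2 + p.1.toNat) * g (p.2 + (-p.1).toNat)) (A * B) :=
    (jaEquiv.hasSum_iff (f := fun p : ℕ × ℕ => f p.1 * g p.2)).2 H
  exact H'.prod_fiberwise (fun k => (H'.summable.prod_factor k).hasSum)

lemma ja_prod (a c : ℂ) :
    HasSum (fun k : ℤ => ∑' j : ℕ, a ^ (j + k.toNat) / ((j + k.toNat).factorial : ℂ) *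
      (c ^ (j + (-k).toNat) / ((j + (-k).toNat).factorial : ℂ))) (Complex.exp (a + c)) := by
  rw [Complex.exp_add]
  exact ja_fiber (fun n : ℕ => a ^ n / (n.factorial : ℂ)) (fun n : ℕ => c ^ n / (n.factorial : ℂ))
    _ _ (ja_exp a) (ja_exp c) (ja_norm a) (ja_norm c)

lemma ja_hasSum (w y : ℝ) :
    HasSum (fun k : ℤ => (besselJ k w : ℂ) * Complex.exp (k * y * Complex.I))
      (Complex.exp (w * Real.sin y * Complex.I)) := by
  have h1 := ja_prod ((w / 2 : ℂ) * Complex.exp (y * Complex.I))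
    (-(w / 2 : ℂ) * Complex.exp (-(y * Complex.I)))
  simp_rw [ja_term, tsum_mul_right, ← Complex.ofReal_tsum, ja_inner] at h1
  have h2 : (w / 2 : ℂ) * Complex.exp (y * Complex.I) +
      -(w / 2 : ℂ) * Complex.exp (-(y * Complex.I)) = w * Real.sin y * Complex.I := by
    rw [Complex.ofReal_sin, Complex.sin, neg_mul (y : ℂ)]
    linear_combination (-(w / 2 : ℂ)) * (Complex.exp (-(y * Complex.I)) -
      Complex.exp (y * Complex.I)) * Complex.I_sq
  rwa [h2] at h1

theorem jacobi_anger_cos_phase (w b y : ℝ) :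
    Summable (fun k : ℤ => besselJ k w * Real.cos (k * y + b)) ∧
    Real.cos (w * Real.sin y + b) = ∑' k : ℤ, besselJ k w * Real.cos (k * y + b) := by
  have h := Complex.hasSum_re ((ja_hasSum w y).mul_right (Complex.exp (b * Complex.I)))
  have h2 : HasSum (fun k : ℤ => besselJ k w * Real.cos (k * y + b))
      (Real.cos (w * Real.sin y + b)) := by
    convert h using 1
    · funext k
      rw [mul_assoc, ← Complex.exp_add, ← add_mul, Complex.re_ofReal_mul,
        ← Complex.exp_ofReal_mul_I_re]
      push_cast; rfl
    · rw [← Complex.exp_add, ← add_mul, ← Complex.exp_ofReal_mul_I_re]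
      push_cast; rfl
  exact ⟨h2.summable, h2.tsum_eq.symm⟩
end
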